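/- Let (P_k)_{k∈K} be a factorized Markov kernel on Z with Dobrushin influence bound C, and suppose there are β ≥ 0 and ρ ≥ 0 with Σ_{j∈K} e^{β d(j,k)} C_{kj} ≤ ρ for every k ∈ K. For z ∈ Z define the t-step laws d_t^z on Z by d_0^z = δ_z and d_{t+1}^z(z') = Σ_{y∈Z} d_t^z(y) P(z'|y), and let d_{t,k}^z denote the marginal of d_t^z on Z_k. Fix k ∈ K, r ∈ ℕ, and z, z̃ ∈ Z with z_j = z̃_j for all j ∈ N_k^r = {j ∈ K : d(j,k) ≤ r}. Then for every t ≥ 1, TV(d_{t,k}^z, d_{t,k}^{z̃}) ≤ ρ^t · e^{−β r}. -/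

import Mathlib

open scoped BigOperators

noncomputable section

/-- Total variation distance between two distributions on a finite type. -/
def tv {X : Type*} [Fintype X] (μ ν : X → ℝ) : ℝ := (∑ x, |μ x - ν x|) / 2

/-- `t`-step laws of the factorized Markov chain with local kernels `P k`, started at the
Dirac mass at `z`. -/
def stepLaw {K : Type*} [Fintype K] [DecidableEq K] {Z : K → Type*}
    [∀ k, Fintype (Z k)] [∀ k, DecidableEq (Z k)]
    (P : ∀ k, (∀ j, Z j) → Z k → ℝ) : ℕ → (∀ j, Z j) → (∀ j, Z j) → ℝ
  | 0, z, z' => if z' = z then 1 else 0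
  | t + 1, z, z' => ∑ y, stepLaw P t z y * ∏ k, P k y (z' k)

/-- Marginal of a distribution on the product space at coordinate `k`. -/
def marginal {K : Type*} [Fintype K] [DecidableEq K] {Z : K → Type*}
    [∀ k, Fintype (Z k)] [∀ k, DecidableEq (Z k)]
    (μ : (∀ j, Z j) → ℝ) (k : K) (x : Z k) : ℝ :=
  ∑ y, if y k = x then μ y else 0


lemma aux_osc {X : Type*} [Fintype X] [Nonempty X] (f h : X → ℝ) (a : ℝ)
    (hf : ∀ x y, |f x - f y| ≤ a) (hh : ∑ x, h x = 0) :
    |∑ x, f x * h x| ≤ a * ((∑ x, |h x|) / 2) := by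
  obtain ⟨M, -, hM⟩ := Finset.exists_max_image (Finset.univ : Finset X) f Finset.univ_nonempty
  obtain ⟨m, -, hm⟩ := Finset.exists_min_image (Finset.univ : Finset X) f Finset.univ_nonempty
  have e : ∑ x, f x * h x = ∑ x, (f x - (f M + f m) / 2) * h x := by
    simp only [sub_mul, Finset.sum_sub_distrib]
    rw [← Finset.mul_sum, hh]; ring
  rw [e]
  refine (Finset.abs_sum_le_sum_abs _ _).trans ?_
  have e2 : a * ((∑ x, |h x|) / 2) = ∑ x, a / 2 * |h x| := by
    rw [← Finset.mul_sum]; ring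
  rw [e2]
  refine Finset.sum_le_sum fun x _ => ?_
  rw [abs_mul]
  refine mul_le_mul_of_nonneg_right ?_ (abs_nonneg _)
  have h1 := hM x (Finset.mem_univ _)
  have h2 := hm x (Finset.mem_univ _)
  have h3 := (abs_le.1 (hf M m)).2
  rw [abs_le]; constructor <;> linarith

section
variable {K : Type*} [Fintype K] [DecidableEq K] {Z : K → Type*}

/-- Oscillation bound. -/
def Osc (f : (∀ j, Z j) → ℝ) (a : K → ℝ) : Prop :=
  ∀ j (z z' : ∀ l, Z l), (∀ l, l ≠ j → z l = z' l) → |f z - f z'| ≤ a j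

lemma osc_diff [∀ k, DecidableEq (Z k)] (f : (∀ j, Z j) → ℝ) (a : K → ℝ) (hf : Osc f a)
    (z z' : ∀ l, Z l) : |f z - f z'| ≤ ∑ j, if z j = z' j then 0 else a j := by
  have key : ∀ s : Finset K, |f z - f (s.piecewise z' z)| ≤
      ∑ j ∈ s, if z j = z' j then 0 else a j := by
    intro s
    induction s using Finset.induction_on with
    | empty => simp
    | insert i s hi ih =>
      rw [Finset.sum_insert hi]
      have h1 : |f (s.piecewise z' z) - f ((insert i s).piecewise z' z)| ≤
          if z i = z' i then 0 else a i := by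
        split_ifs with h
        · have : (insert i s).piecewise z' z = s.piecewise z' z := by
            rw [Finset.piecewise_insert]
            rw [← h]
            have : z i = s.piecewise z' z i := by simp [hi]
            rw [this, Function.update_eq_self]
          rw [this]; simp
        · refine hf i _ _ fun l hl => ?_
          simp [Finset.piecewise, hl]
      have := abs_sub_le (f z) (f (s.piecewise z' z)) (f ((insert i s).piecewise z' z))
      linarith
  simpa using key Finset.univ

variable [∀ k, Fintype (Z k)] [∀ k, Nonempty (Z k)]

lemma prod_one_step (f : (∀ j, Z j) → ℝ) (a : K → ℝ) (hf : Osc f a)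
    (μ ν : ∀ k, Z k → ℝ) (i : K) (hμ0 : ∀ k x, 0 ≤ μ k x) (hμ1 : ∀ k, ∑ x, μ k x = 1)
    (hν1 : ∀ k, ∑ x, ν k x = 1) (hne : ∀ k, k ≠ i → μ k = ν k) :
    |∑ x, (∏ k, μ k (x k)) * f x - ∑ x, (∏ k, ν k (x k)) * f x| ≤ a i * tv (μ i) (ν i) := by
  have hprod : ∀ (ξ : ∀ k, Z k → ℝ) (p : Z i × ∀ j : {j // j ≠ i}, Z j),
      ∏ k, ξ k ((Equiv.piSplitAt i Z).symm p k) = ξ i p.1 * ∏ k : {j // j ≠ i}, ξ k (p.2 k) := by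
    intro ξ p
    rw [← Fintype.prod_subtype_mul_prod_subtype (fun k => k = i)]
    congr 1
    · rw [Finset.prod_eq_single (⟨i, rfl⟩ : {k // k = i})]
      · simp [Equiv.piSplitAt]
      · rintro ⟨x, hx⟩ _ h; exact absurd (Subtype.ext hx) h
      · intro h; exact absurd (@Finset.mem_univ _ (_) _) h
    · refine Fintype.prod_congr _ _ fun k => ?_
      have := k.2
      simp [Equiv.piSplitAt, this]
  rw [← Finset.sum_sub_distrib, ← (Equiv.piSplitAt i Z).symm.sum_comp, Fintype.sum_prod_type_right]
  have e : ∀ y : (∀ j : {j // j ≠ i}, Z j), ∀ u : Z i,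
      (∏ k, μ k ((Equiv.piSplitAt i Z).symm (u, y) k)) * f ((Equiv.piSplitAt i Z).symm (u, y))
      - (∏ k, ν k ((Equiv.piSplitAt i Z).symm (u, y) k)) * f ((Equiv.piSplitAt i Z).symm (u, y))
      = (∏ k : {j // j ≠ i}, μ k (y k)) *
        (f ((Equiv.piSplitAt i Z).symm (u, y)) * (μ i u - ν i u)) := by
    intro y u
    rw [hprod, hprod]
    have : ∏ k : {j // j ≠ i}, ν k (y k) = ∏ k : {j // j ≠ i}, μ k (y k) :=
      Fintype.prod_congr _ _ fun k => by rw [hne k k.2]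
    simp only [this]; ring
  simp only [e, ← Finset.mul_sum]
  refine (Finset.abs_sum_le_sum_abs _ _).trans ?_
  have hw : ∑ y : (∀ j : {j // j ≠ i}, Z j), ∏ k : {j // j ≠ i}, μ k (y k) = 1 := by
    have := Finset.prod_univ_sum (fun k : {j // j ≠ i} => (Finset.univ : Finset (Z k)))
      (fun k x => μ k x)
    rw [Fintype.piFinset_univ] at this
    rw [← this]; simp [hμ1]
  calc _ ≤ ∑ y : (∀ j : {j // j ≠ i}, Z j), (∏ k : {j // j ≠ i}, μ k (y k)) *
        (a i * tv (μ i) (ν i)) := by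
        refine Finset.sum_le_sum fun y _ => ?_
        have h0 : 0 ≤ ∏ k : {j // j ≠ i}, μ k (y k) := Finset.prod_nonneg fun k _ => hμ0 _ _
        rw [abs_mul, abs_of_nonneg h0]
        refine mul_le_mul_of_nonneg_left ?_ h0
        refine aux_osc (fun u => f ((Equiv.piSplitAt i Z).symm (u, y))) (fun u => μ i u - ν i u)
          (a i) ?_ ?_
        · intro u v
          refine hf i _ _ fun l hl => ?_
          simp [Equiv.piSplitAt, hl]
        · simp [hμ1, hν1]
    _ = _ := by rw [← Finset.sum_mul, hw, one_mul]

lemma prod_diff (f : (∀ j, Z j) → ℝ) (a : K → ℝ) (hf : Osc f a)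
    (μ ν : ∀ k, Z k → ℝ) (hμ0 : ∀ k x, 0 ≤ μ k x) (hμ1 : ∀ k, ∑ x, μ k x = 1)
    (hν0 : ∀ k x, 0 ≤ ν k x) (hν1 : ∀ k, ∑ x, ν k x = 1) :
    |∑ x, (∏ k, μ k (x k)) * f x - ∑ x, (∏ k, ν k (x k)) * f x| ≤
      ∑ i, a i * tv (μ i) (ν i) := by
  have key : ∀ s : Finset K, |∑ x, (∏ k, μ k (x k)) * f x -
      ∑ x, (∏ k, (s.piecewise ν μ) k (x k)) * f x| ≤ ∑ i ∈ s, a i * tv (μ i) (ν i) := by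
    intro s
    induction s using Finset.induction_on with
    | empty => simp
    | insert i s hi ih =>
      rw [Finset.sum_insert hi]
      have h1 := prod_one_step f a hf (s.piecewise ν μ) ((insert i s).piecewise ν μ) i
        (fun k x => by by_cases h : k ∈ s <;> simp [h, hμ0, hν0])
        (fun k => by by_cases h : k ∈ s <;> simp [h, hμ1, hν1])
        (fun k => by by_cases h : k ∈ insert i s <;> simp only [Finset.piecewise, h, if_true, if_false, hμ1, hν1])
        (fun k hk => by simp [Finset.piecewise, hk])
      have e1 : s.piecewise ν μ i = μ i := by simp [hi]
      have e2 : (insert i s).piecewise ν μ i = ν i := by simp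
      rw [e1, e2] at h1
      have := abs_sub_le (∑ x, (∏ k, μ k (x k)) * f x)
        (∑ x, (∏ k, (s.piecewise ν μ) k (x k)) * f x)
        (∑ x, (∏ k, ((insert i s).piecewise ν μ) k (x k)) * f x)
      linarith
  simpa using key Finset.univ

lemma main_ind [∀ k, DecidableEq (Z k)] (G : SimpleGraph K) (hG : G.Connected)
    (P : ∀ k, (∀ j, Z j) → Z k → ℝ)
    (hP0 : ∀ k z x, 0 ≤ P k z x) (hP1 : ∀ k z, ∑ x, P k z x = 1)
    (C : K → K → ℝ) (hC0 : ∀ i j, 0 ≤ C i j)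
    (hC : ∀ i j (z z' : ∀ l, Z l), (∀ l, l ≠ j → z l = z' l) →
      tv (P i z) (P i z') ≤ C i j)
    (β ρ : ℝ) (hβ : 0 ≤ β) (hρ : 0 ≤ ρ)
    (hsum : ∀ k, ∑ j, Real.exp (β * G.dist j k) * C k j ≤ ρ)
    (k : K) (r : ℕ) (z zt : ∀ l, Z l)
    (hagree : ∀ j, G.dist j k ≤ r → z j = zt j) (t : ℕ) :
    ∀ (f : (∀ j, Z j) → ℝ) (a : K → ℝ) (A : ℝ), Osc f a → (∀ j, 0 ≤ a j) →
      ∑ j, Real.exp (β * G.dist j k) * a j ≤ A →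
      |∑ x, stepLaw P t z x * f x - ∑ x, stepLaw P t zt x * f x| ≤
        ρ ^ t * A * Real.exp (-β * r) := by
  induction t with
  | zero =>
    intro f a A hf ha hA
    simp only [stepLaw, ite_mul, one_mul, zero_mul, Finset.sum_ite_eq', Finset.mem_univ, if_true,
      pow_zero]
    refine (osc_diff f a hf z zt).trans ?_
    refine le_trans ?_ (mul_le_mul_of_nonneg_right hA (Real.exp_nonneg _))
    rw [Finset.sum_mul]
    refine Finset.sum_le_sum fun j _ => ?_
    split_ifs with h
    · have := ha j
      positivity
    · have h1 : r ≤ G.dist j k := by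
        by_contra h2
        exact h (hagree j (by omega))
      have h2 : (r : ℝ) ≤ G.dist j k := by exact_mod_cast h1
      have h3 : 1 ≤ Real.exp (β * G.dist j k) * Real.exp (-β * r) := by
        rw [← Real.exp_add]
        apply Real.one_le_exp
        nlinarith
      nlinarith [ha j]
  | succ t ih =>
    intro f a A hf ha hA
    have e : ∀ w, ∑ x, stepLaw P (t + 1) w x * f x =
        ∑ y, stepLaw P t w y * ∑ x, (∏ k, P k y (x k)) * f x := by
      intro w
      simp only [stepLaw, Finset.sum_mul, Finset.mul_sum]
      rw [Finset.sum_comm]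
      simp only [mul_assoc]
    rw [e, e]
    have := ih (fun y => ∑ x, (∏ k, P k y (x k)) * f x) (fun j => ∑ i, a i * C i j) (ρ * A)
      ?_ (fun j => Finset.sum_nonneg fun i _ => mul_nonneg (ha i) (hC0 i j)) ?_
    · refine this.trans (le_of_eq ?_)
      ring
    · intro j y y' hy
      refine (prod_diff f a hf (fun k => P k y) (fun k => P k y') (fun k => hP0 k y)
        (fun k => hP1 k y) (fun k => hP0 k y') (fun k => hP1 k y')).trans ?_
      exact Finset.sum_le_sum fun i _ => mul_le_mul_of_nonneg_left (hC i j y y' hy) (ha i)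
    · refine le_trans ?_ (mul_le_mul_of_nonneg_left hA hρ)
      simp only [Finset.mul_sum]
      rw [Finset.sum_comm]
      refine Finset.sum_le_sum fun i _ => ?_
      calc _ ≤ ∑ j, (Real.exp (β * G.dist i k) * a i) * (Real.exp (β * G.dist j i) * C i j) := by
            refine Finset.sum_le_sum fun j _ => ?_
            have h1 : (G.dist j k : ℝ) ≤ G.dist j i + G.dist i k := by
              exact_mod_cast hG.dist_triangle
            have h2 : Real.exp (β * G.dist j k) ≤
                Real.exp (β * G.dist i k) * Real.exp (β * G.dist j i) := by
              rw [← Real.exp_add]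
              apply Real.exp_le_exp.2
              nlinarith
            have := mul_le_mul_of_nonneg_right h2 (mul_nonneg (ha i) (hC0 i j))
            nlinarith
        _ ≤ _ := by
            rw [← Finset.mul_sum, mul_comm ρ]
            exact mul_le_mul_of_nonneg_left (hsum i) (mul_nonneg (Real.exp_nonneg _) (ha i))

end

/-- under the weighted Dobrushin condition, if two starting states agree on
the neighborhood `N_k^r`, then the marginals at site `k` of the `t`-step laws satisfy
`TV ≤ ρ^t e^{-β r}`. -/
theorem stmt3 {K : Type*} [Fintype K] [DecidableEq K] [Nonempty K]
    (G : SimpleGraph K) (hG : G.Connected)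
    {Z : K → Type*} [∀ k, Fintype (Z k)] [∀ k, DecidableEq (Z k)] [∀ k, Nonempty (Z k)]
    (P : ∀ k, (∀ j, Z j) → Z k → ℝ)
    (hP0 : ∀ k z x, 0 ≤ P k z x) (hP1 : ∀ k z, ∑ x, P k z x = 1)
    (C : K → K → ℝ) (hC0 : ∀ i j, 0 ≤ C i j)
    (hC : ∀ i j (z z' : ∀ l, Z l), (∀ l, l ≠ j → z l = z' l) →
      tv (P i z) (P i z') ≤ C i j)
    (β ρ : ℝ) (hβ : 0 ≤ β) (hρ : 0 ≤ ρ)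
    (hsum : ∀ k, ∑ j, Real.exp (β * G.dist j k) * C k j ≤ ρ)
    (k : K) (r : ℕ) (z zt : ∀ l, Z l)
    (hagree : ∀ j, G.dist j k ≤ r → z j = zt j)
    (t : ℕ) (ht : 1 ≤ t) :
    tv (marginal (stepLaw P t z) k) (marginal (stepLaw P t zt) k) ≤
      ρ ^ t * Real.exp (-β * r) := by
  set μ := stepLaw P t z with hμ
  set ν := stepLaw P t zt with hν
  let s : Z k → ℝ := fun x => if 0 ≤ marginal μ k x - marginal ν k x then 1 / 2 else -(1 / 2)
  have hm : ∀ ξ : (∀ j, Z j) → ℝ, ∑ y, ξ y * s (y k) = ∑ x, s x * marginal ξ k x := by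
    intro ξ
    simp only [marginal, Finset.mul_sum]
    rw [Finset.sum_comm]
    refine Finset.sum_congr rfl fun y _ => ?_
    simp [mul_comm]
  have htv : tv (marginal μ k) (marginal ν k) = ∑ y, μ y * s (y k) - ∑ y, ν y * s (y k) := by
    rw [hm, hm, ← Finset.sum_sub_distrib, tv, Finset.sum_div]
    refine Finset.sum_congr rfl fun x _ => ?_
    simp only [s]
    split_ifs with h
    · rw [abs_of_nonneg h]; ring
    · rw [abs_of_neg (not_le.1 h)]; ring
  rw [htv]
  refine (le_abs_self _).trans ?_
  have := main_ind G hG P hP0 hP1 C hC0 hC β ρ hβ hρ hsum k r z zt hagree t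
    (fun y => s (y k)) (fun j => if j = k then 1 else 0) 1 ?_ ?_ ?_
  · simpa using this
  · intro j y y' h
    by_cases hj : j = k
    · simp only [hj, if_true, s]
      split_ifs <;> norm_num
    · simp [hj, h k (Ne.symm hj)]
  · intro j
    split_ifs <;> norm_num
  · simp
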